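/- Let p_1, …, p_c ∈ H with ‖p_j‖ ≤ P, let r, h₁, h₂ ∈ H with ‖h₁‖ ≤ B and ‖h₂‖ ≤ B, let β_c > 0, β_h > 0, γ > 0, η > 0, and let z ∈ {1,…,c} satisfy ⟨r, p_z⟩ ≥ ⟨r, p_j⟩ + γ for all j ≠ z and ⟨h₂, p_z⟩ ≥ ⟨h₁, p_z⟩ + η. Define w = Σ_{j=1}^{c} α^{class}_j p_j with α^{class}_j = exp(β_c ⟨r, p_j⟩)/Σ_{k=1}^{c} exp(β_c ⟨r, p_k⟩); define hop weights α_k = exp(β_h ⟨h_k, w⟩)/(exp(β_h ⟨h₁, w⟩) + exp(β_h ⟨h₂, w⟩)) for k ∈ {1,2}, and set h = α₁ h₁ + α₂ h₂. If 4BP(c − 1) e^{−β_c γ} ≤ η/2, then ‖h − h₂‖ ≤ 2B e^{−β_h η/2}. -/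

import Mathlib

open Finset
open scoped RealInnerProductSpace

/-- Softmax weights with temperature `β` on a score vector `s : Fin c → ℝ`. -/
noncomputable def softmax {c : ℕ} (β : ℝ) (s : Fin c → ℝ) (j : Fin c) : ℝ :=
  Real.exp (β * s j) / ∑ k, Real.exp (β * s k)

theorem softmax_nonneg {c : ℕ} (β : ℝ) (s : Fin c → ℝ) (j : Fin c) : 0 ≤ softmax β s j := by
  unfold softmax
  positivity

theorem sum_softmax {c : ℕ} (β : ℝ) (s : Fin c → ℝ) (z : Fin c) : ∑ j, softmax β s j = 1 := by
  have hpos : 0 < ∑ k, Real.exp (β * s k) :=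
    Finset.sum_pos (fun k _ => Real.exp_pos _) ⟨z, Finset.mem_univ z⟩
  simp only [softmax]
  rw [← Finset.sum_div, div_self hpos.ne']

/-- A score that is smaller than another one by at least `γ` has softmax weight
at most `exp (-(β * γ))`. -/
theorem softmax_le_exp_neg {c : ℕ} {β γ : ℝ} (hβ : 0 ≤ β) {s : Fin c → ℝ} {j z : Fin c}
    (hs : s j + γ ≤ s z) : softmax β s j ≤ Real.exp (-(β * γ)) := by
  have hpos : 0 < ∑ k, Real.exp (β * s k) :=
    Finset.sum_pos (fun k _ => Real.exp_pos _) ⟨z, Finset.mem_univ z⟩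
  have hz : Real.exp (β * s z) ≤ ∑ k, Real.exp (β * s k) :=
    Finset.single_le_sum (f := fun k => Real.exp (β * s k))
      (fun k _ => (Real.exp_pos _).le) (Finset.mem_univ z)
  rw [softmax, div_le_iff₀ hpos]
  calc Real.exp (β * s j) ≤ Real.exp (-(β * γ)) * Real.exp (β * s z) := by
        rw [← Real.exp_add]
        apply Real.exp_le_exp.mpr
        nlinarith [mul_le_mul_of_nonneg_left hs hβ]
    _ ≤ _ := by gcongr

/-- Under a score margin `γ` for the index `z`, the softmax average of vectors of norm at most `P`
is exponentially close to the `z`-th vector. -/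
theorem norm_softmax_average_sub_le {E : Type*} [NormedAddCommGroup E] [NormedSpace ℝ E] {c : ℕ}
    {β γ P : ℝ} (hβ : 0 ≤ β) {s : Fin c → ℝ} {z : Fin c} (hs : ∀ j, j ≠ z → s j + γ ≤ s z)
    {p : Fin c → E} (hp : ∀ j, ‖p j‖ ≤ P) :
    ‖∑ j, softmax β s j • p j - p z‖ ≤ ((c : ℝ) - 1) * (Real.exp (-(β * γ)) * (2 * P)) := by
  have hsub : ∑ j, softmax β s j • p j - p z
      = ∑ j ∈ Finset.univ.erase z, softmax β s j • (p j - p z) := by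
    rw [Finset.sum_erase _ (by simp)]
    simp only [smul_sub, Finset.sum_sub_distrib]
    rw [← Finset.sum_smul, sum_softmax β s z, one_smul]
  have hcard : ((Finset.univ.erase z).card : ℝ) = (c : ℝ) - 1 := by
    rw [Finset.cast_card_erase_of_mem (Finset.mem_univ z), Finset.card_univ, Fintype.card_fin]
  rw [hsub, ← hcard, ← nsmul_eq_mul]
  refine (norm_sum_le _ _).trans (Finset.sum_le_card_nsmul _ _ _ fun j hj => ?_)
  rw [norm_smul, Real.norm_of_nonneg (softmax_nonneg β s j)]
  refine mul_le_mul (softmax_le_exp_neg hβ (hs j (Finset.ne_of_mem_erase hj))) ?_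
    (norm_nonneg _) (Real.exp_pos _).le
  linarith [norm_sub_le (p j) (p z), hp j, hp z]

/-- Under a class margin `γ` and a hop margin `η`, if `4BP(c−1) e^{−β_c γ} ≤ η/2`,
then the prototype-gated hop fusion `h = α₁ h₁ + α₂ h₂` satisfies
`‖h − h₂‖ ≤ 2B e^{−β_h η/2}`. -/
theorem hop_fusion_close_to_informative_hop {H : Type*} [NormedAddCommGroup H]
    [InnerProductSpace ℝ H] {c : ℕ} (p : Fin c → H) (P B : ℝ) (hp : ∀ j, ‖p j‖ ≤ P)
    (r h₁ h₂ : H) (hb1 : ‖h₁‖ ≤ B) (hb2 : ‖h₂‖ ≤ B)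
    (βc βh γ η : ℝ) (hβc : 0 < βc) (hβh : 0 < βh) (hγ : 0 < γ) (hη : 0 < η) (z : Fin c)
    (hmargin : ∀ j, j ≠ z → ⟪r, p j⟫ + γ ≤ ⟪r, p z⟫)
    (hhop : ⟪h₁, p z⟫ + η ≤ ⟪h₂, p z⟫)
    (w : H) (hw : w = ∑ j, softmax βc (fun k => ⟪r, p k⟫) j • p j)
    (α₁ α₂ : ℝ)
    (hα₁ : α₁ = Real.exp (βh * ⟪h₁, w⟫) /
        (Real.exp (βh * ⟪h₁, w⟫) + Real.exp (βh * ⟪h₂, w⟫)))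
    (hα₂ : α₂ = Real.exp (βh * ⟪h₂, w⟫) /
        (Real.exp (βh * ⟪h₁, w⟫) + Real.exp (βh * ⟪h₂, w⟫)))
    (h : H) (hh : h = α₁ • h₁ + α₂ • h₂)
    (hcond : 4 * B * P * ((c : ℝ) - 1) * Real.exp (-(βc * γ)) ≤ η / 2) :
    ‖h - h₂‖ ≤ 2 * B * Real.exp (-(βh * η / 2)) := by
  have hB : 0 ≤ B := (norm_nonneg h₁).trans hb1
  have hdist : ‖w - p z‖ ≤ ((c : ℝ) - 1) * (Real.exp (-(βc * γ)) * (2 * P)) := by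
    rw [hw]
    exact norm_softmax_average_sub_le hβc.le hmargin hp
  have hdiff : ‖h₁ - h₂‖ ≤ 2 * B := by linarith [norm_sub_le h₁ h₂]
  have hinner : ⟪h₁ - h₂, w - p z⟫ ≤ η / 2 :=
    calc ⟪h₁ - h₂, w - p z⟫ ≤ ‖h₁ - h₂‖ * ‖w - p z‖ := real_inner_le_norm _ _
      _ ≤ 2 * B * (((c : ℝ) - 1) * (Real.exp (-(βc * γ)) * (2 * P))) :=
        mul_le_mul hdiff hdist (norm_nonneg _) (by positivity)
      _ = 4 * B * P * ((c : ℝ) - 1) * Real.exp (-(βc * γ)) := by ring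
      _ ≤ η / 2 := hcond
  have hgap : ⟪h₁, w⟫ + η / 2 ≤ ⟪h₂, w⟫ := by
    simp only [inner_sub_left, inner_sub_right] at hinner
    linarith
  have hα₁_nonneg : 0 ≤ α₁ := by
    rw [hα₁]
    positivity
  have hα₁_le : α₁ ≤ Real.exp (-(βh * η / 2)) := by
    have hsoft := softmax_le_exp_neg hβh.le (s := ![⟪h₁, w⟫, ⟪h₂, w⟫]) (j := 0) (z := 1)
      (γ := η / 2) (by simpa using hgap)
    rw [hα₁, mul_div_assoc]
    simpa [softmax, Fin.sum_univ_two] using hsoft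
  have hsum : α₁ + α₂ = 1 := by
    rw [hα₁, hα₂, ← add_div, div_self (by positivity)]
  have hfuse : h - h₂ = α₁ • (h₁ - h₂) := by
    rw [hh, eq_sub_of_add_eq' hsum]
    module
  rw [hfuse, norm_smul, Real.norm_of_nonneg hα₁_nonneg, mul_comm (2 * B)]
  exact mul_le_mul hα₁_le hdiff (norm_nonneg _) (Real.exp_pos _).le
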